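/- Let n ≥ 2 be an integer. There exist C > 0 and a positive integer k (depending only on n) such that for every finite field K of characteristic ≠ 2, for every maximal torus T of SL_n over the algebraic closure K̄, and for every set A ⊆ SL_n(K) generating SL_n(K), we have |A ∩ T(K)| ≤ C·|A_k|^{1/(n+1)}. -/

import Mathlib

open Pointwise

/-- `A_r = (A ∪ A⁻¹ ∪ {1})^r`. -/
def prodSet {G : Type*} [Group G] (A : Set G) (r : ℕ) : Set G :=
  (A ∪ A⁻¹ ∪ {1}) ^ r

/-- A maximal torus of `SL_n` over a field `L`: a subgroup of the form `γ D γ⁻¹`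
where `D` is the set of diagonal matrices in `SL_n(L)` and `γ ∈ GL_n(L)`. -/
def IsMaxTorus (n : ℕ) (L : Type*) [Field L]
    (T : Set (Matrix.SpecialLinearGroup (Fin n) L)) : Prop :=
  ∃ γ : (Matrix (Fin n) (Fin n) L)ˣ,
    T = {x : Matrix.SpecialLinearGroup (Fin n) L | ∃ d : Matrix (Fin n) (Fin n) L, d.IsDiag ∧
      (x : Matrix (Fin n) (Fin n) L) = (γ : Matrix (Fin n) (Fin n) L) * d *
        ((γ⁻¹ : (Matrix (Fin n) (Fin n) L)ˣ) : Matrix (Fin n) (Fin n) L)}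

/-- The `K`-points `T(K)` of a torus `T ⊆ SL_n(K̄)`: those `x ∈ SL_n(K)` that lie in `T`
when viewed in `SL_n(K̄)`. -/
def torusPoints (n : ℕ) (K : Type*) [Field K]
    (T : Set (Matrix.SpecialLinearGroup (Fin n) (AlgebraicClosure K))) :
    Set (Matrix.SpecialLinearGroup (Fin n) K) :=
  {x | Matrix.SpecialLinearGroup.map (algebraMap K (AlgebraicClosure K)) x ∈ T}

section SubmodulePowers

variable {L R : Type*} [Field L] [CommRing R] [Algebra L R] {W : Submodule L R}

theorem Submodule.pow_le_pow_of_one_mem (h1 : (1 : R) ∈ W) {a b : ℕ} (h : a ≤ b) :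
    W ^ a ≤ W ^ b :=
  pow_le_pow_right₀ (Submodule.one_le.mpr h1) h

theorem Submodule.mul_mem_pow {a b : ℕ} {x y : R} (hx : x ∈ W ^ a) (hy : y ∈ W ^ b) :
    x * y ∈ W ^ (a + b) := by
  rw [pow_add]
  exact Submodule.mul_mem_mul hx hy

theorem Submodule.algebraMap_mem_pow (h1 : (1 : R) ∈ W) (a : ℕ) (c : L) :
    algebraMap L R c ∈ W ^ a := by
  refine Submodule.pow_le_pow_of_one_mem h1 (Nat.zero_le a) ?_
  rw [pow_zero]
  exact Submodule.algebraMap_mem c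

theorem Submodule.prod_mem_pow_mul {ι : Type*} (s : Finset ι) {a : ℕ} {f : ι → R}
    (hf : ∀ i ∈ s, f i ∈ W ^ a) : ∏ i ∈ s, f i ∈ W ^ (s.card * a) := by
  classical
  induction s using Finset.induction_on with
  | empty => simpa using Submodule.algebraMap_mem (R := L) (A := R) 1
  | insert i s hi ih =>
    rw [Finset.prod_insert hi, Finset.card_insert_of_notMem hi, add_one_mul, add_comm]
    exact Submodule.mul_mem_pow (hf _ (Finset.mem_insert_self ..))
      (ih fun j hj => hf j (Finset.mem_insert_of_mem hj))

variable {m : Type*} [Fintype m] [DecidableEq m]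

omit [DecidableEq m] in
theorem Matrix.mul_apply_mem_pow {a b : ℕ} {M N : Matrix m m R} (hM : ∀ i j, M i j ∈ W ^ a)
    (hN : ∀ i j, N i j ∈ W ^ b) (i j : m) : (M * N) i j ∈ W ^ (a + b) := by
  rw [Matrix.mul_apply]
  exact Submodule.sum_mem _ fun k _ => Submodule.mul_mem_pow (hM i k) (hN k j)

theorem Matrix.map_algebraMap_mem_pow (h1 : (1 : R) ∈ W) (a : ℕ) (M : Matrix m m L) (i j : m) :
    (algebraMap L R).mapMatrix M i j ∈ W ^ a :=
  Submodule.algebraMap_mem_pow h1 a _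

theorem Matrix.det_mem_pow {a : ℕ} {M : Matrix m m R} (hM : ∀ i j, M i j ∈ W ^ a) :
    M.det ∈ W ^ (Fintype.card m * a) := by
  rw [Matrix.det_apply]
  refine Submodule.sum_mem _ fun σ _ => ?_
  rw [Units.smul_def]
  exact zsmul_mem (Submodule.prod_mem_pow_mul _ fun i _ => hM _ _) _

theorem Matrix.adjugate_apply_mem_pow (h1 : (1 : R) ∈ W) {a : ℕ} {M : Matrix m m R}
    (hM : ∀ i j, M i j ∈ W ^ a) (i j : m) :
    M.adjugate i j ∈ W ^ (Fintype.card m * a) := by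
  rw [Matrix.adjugate_apply]
  refine Matrix.det_mem_pow fun k l => ?_
  rw [Matrix.updateRow_apply]
  split_ifs
  · rw [Pi.single_apply]
    split_ifs
    · simpa using Submodule.algebraMap_mem_pow h1 a 1
    · exact zero_mem _
  · exact hM k l

theorem Matrix.partialProd_apply_mem_pow (h1 : (1 : R) ∈ W) {n a : ℕ} {u : Fin n → Matrix m m R}
    (hu : ∀ k i j, u k i j ∈ W ^ a) (k : Fin (n + 1)) (i j : m) :
    Fin.partialProd u k i j ∈ W ^ (k.val * a) := by
  induction k using Fin.induction generalizing i j with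
  | zero =>
    have h := Matrix.map_algebraMap_mem_pow h1 (0 * a) (1 : Matrix m m L) i j
    rw [map_one] at h
    exact h
  | succ k ih =>
    rw [Fin.partialProd_succ]
    simpa [add_one_mul] using Matrix.mul_apply_mem_pow ih (hu k) i j

end SubmodulePowers

section VariableSpan

variable (σ L : Type*) [Field L]

/-- The space of polynomials of degree at most one. -/
noncomputable def degreeOneSpan : Submodule L (MvPolynomial σ L) :=
  Submodule.span L (insert 1 (Set.range MvPolynomial.X))

variable {σ L}

theorem one_mem_degreeOneSpan : (1 : MvPolynomial σ L) ∈ degreeOneSpan σ L :=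
  Submodule.subset_span (Set.mem_insert _ _)

theorem X_mem_degreeOneSpan (i : σ) : (MvPolynomial.X i : MvPolynomial σ L) ∈ degreeOneSpan σ L :=
  Submodule.subset_span (Set.mem_insert_of_mem _ ⟨i, rfl⟩)

theorem totalDegree_le_of_mem_degreeOneSpan_pow {a : ℕ} {f : MvPolynomial σ L}
    (hf : f ∈ degreeOneSpan σ L ^ a) : f.totalDegree ≤ a := by
  have h : degreeOneSpan σ L ≤ MvPolynomial.restrictTotalDegree σ L 1 := by
    rw [degreeOneSpan, Submodule.span_le]
    rintro _ (rfl | ⟨i, rfl⟩)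
    · simp [MvPolynomial.mem_restrictTotalDegree]
    · simp [MvPolynomial.mem_restrictTotalDegree]
  induction a generalizing f with
  | zero =>
    rw [pow_zero, Submodule.mem_one] at hf
    obtain ⟨c, rfl⟩ := hf
    simp [MvPolynomial.algebraMap_eq]
  | succ a ih =>
    rw [pow_succ] at hf
    rw [← MvPolynomial.mem_restrictTotalDegree]
    refine Submodule.mul_induction_on hf (fun p hp q hq => ?_) fun p q hp hq => add_mem hp hq
    rw [MvPolynomial.mem_restrictTotalDegree]
    exact (MvPolynomial.totalDegree_mul p q).trans
      (add_le_add (ih hp) ((MvPolynomial.mem_restrictTotalDegree ..).1 (h hq)))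

end VariableSpan

section Escape

variable {Γ L : Type*} [Group Γ] [Field L]

theorem eq_zero_of_vanishes_on_pow (W : Submodule L (Γ → L)) [FiniteDimensional L W] {m : ℕ}
    (hm : Module.finrank L W ≤ m) {S : Set Γ} (h1 : (1 : Γ) ∈ S)
    (hS : ∀ g : Γ, ∃ k : ℕ, g ∈ S ^ k)
    (hW : ∀ s ∈ S, ∀ f ∈ W, (fun g => f (s * g)) ∈ W)
    {f : Γ → L} (hf : f ∈ W) (h0 : ∀ g ∈ S ^ m, f g = 0) : f = 0 := by
  let U : ℕ → Submodule L (Γ → L) := fun k =>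
    { carrier := {f | f ∈ W ∧ ∀ g ∈ S ^ k, f g = 0}
      add_mem' := fun ha hb => ⟨add_mem ha.1 hb.1, fun g hg => by
        simp [ha.2 g hg, hb.2 g hg]⟩
      zero_mem' := ⟨zero_mem _, fun _ _ => rfl⟩
      smul_mem' := fun c a ha => ⟨W.smul_mem c ha.1, fun g hg => by simp [ha.2 g hg]⟩ }
  have hUW (k : ℕ) : U k ≤ W := fun f hf => hf.1
  have hfin (k : ℕ) : FiniteDimensional L (U k) := Submodule.finiteDimensional_of_le (hUW k)
  have hstep (k : ℕ) : U (k + 1) ≤ U k := fun f hf =>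
    ⟨hf.1, fun g hg => hf.2 g (Set.pow_subset_pow_right h1 (Nat.le_succ k) hg)⟩
  have hstab (k : ℕ) (hk : U (k + 1) = U k) : U k = ⊥ := by
    have htr : ∀ s ∈ S, ∀ f ∈ U k, (fun g => f (s * g)) ∈ U k := fun s hs f hf =>
      ⟨hW s hs f hf.1, fun g hg => (hk ▸ hf).2 _ (by
        rw [pow_succ']
        exact Set.mul_mem_mul hs hg)⟩
    have hvan (j : ℕ) : ∀ f ∈ U k, ∀ g ∈ S ^ j, f g = 0 := by
      induction j with
      | zero =>
        intro f hf g hg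
        obtain rfl : g = 1 := by simpa using hg
        exact hf.2 1 (Set.one_mem_pow h1)
      | succ j ih =>
        intro f hf g hg
        rw [pow_succ'] at hg
        obtain ⟨s, hs, g', hg', rfl⟩ := hg
        exact ih _ (htr s hs f hf) g' hg'
    refine (Submodule.eq_bot_iff _).2 fun f hf => funext fun g => ?_
    obtain ⟨j, hj⟩ := hS g
    exact hvan j f hf g hj
  have hdim (k : ℕ) : U k = ⊥ ∨ Module.finrank L (U k) + k ≤ m := by
    induction k with
    | zero => exact Or.inr ((Submodule.finrank_mono (hUW 0)).trans hm)
    | succ k ih =>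
      rcases ih with ih | ih
      · exact Or.inl (le_bot_iff.1 (ih ▸ hstep k))
      · rcases eq_or_lt_of_le (hstep k) with h | h
        · exact Or.inl (h.trans (hstab k h))
        · have := Submodule.finrank_lt_finrank_of_lt h
          exact Or.inr (by lia)
  have hbot : U m = ⊥ := by
    rcases hdim m with h | h
    · exact h
    · exact Submodule.finrank_eq_zero.1 (by lia)
  exact (Submodule.mem_bot L).1 (hbot ▸ (show f ∈ U m from ⟨hf, h0⟩))

theorem exists_finset_determining {X : Type*} {S : Set X} (m : ℕ) (W : Submodule L (X → L))
    [FiniteDimensional L W] (hm : Module.finrank L W ≤ m)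
    (h : ∀ f ∈ W, (∀ x ∈ S, f x = 0) → f = 0) :
    ∃ E : Finset X, E.card ≤ m ∧ ↑E ⊆ S ∧ ∀ f ∈ W, (∀ x ∈ E, f x = 0) → f = 0 := by
  classical
  induction m generalizing W with
  | zero =>
    refine ⟨∅, by simp, by simp, fun f hf _ => ?_⟩
    rw [Submodule.finrank_eq_zero.1 (Nat.le_zero.1 hm)] at hf
    exact hf
  | succ m ih =>
    by_cases hW : W = ⊥
    · exact ⟨∅, by simp, by simp, fun f hf _ => by rw [hW] at hf; exact hf⟩
    obtain ⟨f, hf, hf0⟩ := Submodule.exists_mem_ne_zero_of_ne_bot hW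
    obtain ⟨x, hxS, hx⟩ : ∃ x ∈ S, f x ≠ 0 := by
      by_contra! hc
      exact hf0 (h f hf hc)
    let V : Submodule L (X → L) := W ⊓ LinearMap.ker (LinearMap.proj x : (X → L) →ₗ[L] L)
    have hVW : V < W := lt_of_le_of_ne inf_le_left fun he => hx (by
      rw [← he] at hf
      exact hf.2)
    have : FiniteDimensional L V := Submodule.finiteDimensional_of_le hVW.le
    obtain ⟨E, hE, hES, hEV⟩ := ih V
      (by have := Submodule.finrank_lt_finrank_of_lt hVW; lia) fun f hf => h f hf.1
    refine ⟨insert x E, (Finset.card_insert_le _ _).trans (by lia), ?_, fun g hg hg0 => ?_⟩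
    · rw [Finset.coe_insert]
      exact Set.insert_subset hxS hES
    · exact hEV g ⟨hg, hg0 x (Finset.mem_insert_self _ _)⟩
        fun y hy => hg0 y (Finset.mem_insert_of_mem hy)

end Escape

section Bezout

open Polynomial (X C)

variable {σ L : Type*} [Fintype σ] [Field L]

omit [Fintype σ] in
theorem MvPolynomial.IsHomogeneous.aeval_mul {A : Type*} [CommRing A] [Algebra L A]
    {φ : MvPolynomial σ L} {l : ℕ} (hφ : φ.IsHomogeneous l) (t : A) (u : σ → A) :
    MvPolynomial.aeval (fun k => t * u k) φ = t ^ l * MvPolynomial.aeval u φ := by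
  rw [MvPolynomial.aeval_def, MvPolynomial.aeval_def, MvPolynomial.eval₂_eq,
    MvPolynomial.eval₂_eq, Finset.mul_sum]
  refine Finset.sum_congr rfl fun d hd => ?_
  have hl : ∑ i ∈ d.support, d i = l := by
    have := hφ (MvPolynomial.mem_support_iff.1 hd)
    rw [Finsupp.weight_apply] at this
    simpa [Finsupp.sum] using this
  simp_rw [mul_pow, Finset.prod_mul_distrib]
  rw [Finset.prod_pow_eq_pow_sum, hl]
  ring

omit [Fintype σ] in
theorem MvPolynomial.exists_aeval_X_mul_eq (Q : MvPolynomial σ L) (m : ℕ)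
    (hQ : ∀ l < m, MvPolynomial.homogeneousComponent l Q = 0) (u : σ → Polynomial L) :
    ∃ e : Polynomial L, MvPolynomial.aeval (fun k => Polynomial.X * u k) Q =
      Polynomial.X ^ m *
        (MvPolynomial.aeval u (MvPolynomial.homogeneousComponent m Q) + Polynomial.X * e) := by
  have key (l : ℕ) : ∃ e : Polynomial L,
      MvPolynomial.aeval (fun k => Polynomial.X * u k) (MvPolynomial.homogeneousComponent l Q) =
      Polynomial.X ^ m * ((if l = m then
        MvPolynomial.aeval u (MvPolynomial.homogeneousComponent m Q) else 0) +
          Polynomial.X * e) := by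
    rcases lt_trichotomy l m with h | rfl | h
    · exact ⟨0, by simp [hQ l h, h.ne]⟩
    · exact ⟨0, by
        simp [(MvPolynomial.homogeneousComponent_isHomogeneous l Q).aeval_mul]⟩
    · refine ⟨Polynomial.X ^ (l - m - 1) *
        MvPolynomial.aeval u (MvPolynomial.homogeneousComponent l Q), ?_⟩
      rw [(MvPolynomial.homogeneousComponent_isHomogeneous l Q).aeval_mul, if_neg h.ne']
      obtain ⟨c, rfl⟩ := Nat.exists_eq_add_of_lt h
      rw [show m + c + 1 - m - 1 = c by lia]
      ring
  choose e he using key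
  refine ⟨∑ l ∈ Finset.range (Q.totalDegree + 1 + m), e l, ?_⟩
  have hsum : Q = ∑ l ∈ Finset.range (Q.totalDegree + 1 + m),
      MvPolynomial.homogeneousComponent l Q := by
    conv_lhs => rw [← MvPolynomial.sum_homogeneousComponent Q]
    refine Finset.sum_subset (Finset.range_subset_range.2 (by lia)) fun l _ hl => ?_
    exact MvPolynomial.homogeneousComponent_eq_zero l Q (by simpa using hl)
  conv_lhs => rw [hsum, map_sum, Finset.sum_congr rfl fun l _ => he l]
  rw [← Finset.mul_sum, Finset.sum_add_distrib, Finset.sum_ite_eq' ,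
    if_pos (Finset.mem_range.2 (by lia)), Finset.mul_sum]

omit [Fintype σ] in
theorem MvPolynomial.exists_interpolation (P : Finset (σ → L)) (p : σ → L) :
    ∃ h : MvPolynomial σ L, MvPolynomial.eval p h = 1 ∧
      ∀ q ∈ P, q ≠ p → MvPolynomial.eval q h = 0 := by
  classical
  induction P using Finset.induction_on with
  | empty => exact ⟨1, by simp, by simp⟩
  | insert q P _ ih =>
    obtain ⟨h, h1, h0⟩ := ih
    by_cases hqp : q = p
    · refine ⟨h, h1, fun q' hq' hne => ?_⟩
      rcases Finset.mem_insert.1 hq' with rfl | hq'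
      · exact absurd hqp hne
      · exact h0 q' hq' hne
    · obtain ⟨k, hk⟩ := Function.ne_iff.1 hqp
      have hk' : p k - q k ≠ 0 := sub_ne_zero.2 (Ne.symm hk)
      refine ⟨h * (MvPolynomial.C (p k - q k)⁻¹ * (MvPolynomial.X k - MvPolynomial.C (q k))),
        by simp [h1, hk'], fun q' hq' hne => ?_⟩
      rcases Finset.mem_insert.1 hq' with rfl | hq'
      · simp
      · simp [h0 q' hq' hne]

/-- The system `f` has independent linear parts at its zero `p`: every first-order displacement `w`
of the values is attained along some line through `p`. -/
def IsNonsingularZero (f : σ → MvPolynomial σ L) (p : σ → L) : Prop :=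
  ∀ w : σ → L, ∃ (v : σ → L) (r : σ → Polynomial L), ∀ k,
    MvPolynomial.aeval (fun i => C (p i) + X * C (v i)) (f k) = X * (C (w k) + X * r k)

omit [Fintype σ] in
theorem eq_zero_of_sum_mul_aeval_eq_zero [Infinite L] {f : σ → MvPolynomial σ L}
    {P : Finset (σ → L)} (hP : ∀ p ∈ P, IsNonsingularZero f p) {h : P → MvPolynomial σ L}
    (h1 : ∀ p : P, MvPolynomial.eval p.1 (h p) = 1)
    (h0 : ∀ p q : P, q ≠ p → MvPolynomial.eval q.1 (h p) = 0)
    {Q : P → MvPolynomial σ L} (hQ : ∑ p, h p * MvPolynomial.aeval f (Q p) = 0) (p : P) :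
    Q p = 0 := by
  suffices H : ∀ m, ∀ p, MvPolynomial.homogeneousComponent m (Q p) = 0 by
    rw [← MvPolynomial.sum_homogeneousComponent (Q p)]
    exact Finset.sum_eq_zero fun m _ => H m p
  intro m
  induction m using Nat.strong_induction_on with
  | _ m ih =>
  intro p
  refine MvPolynomial.funext fun w => ?_
  obtain ⟨v, r, hv⟩ := hP p.1 p.2 w
  let θ : MvPolynomial σ L →ₐ[L] Polynomial L :=
    MvPolynomial.aeval fun i => C (p.1 i) + X * C (v i)
  let u : σ → Polynomial L := fun k => C (w k) + X * r k
  have hθf (q : MvPolynomial σ L) :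
      θ (MvPolynomial.aeval f q) = MvPolynomial.aeval (fun k => X * u k) q := by
    rw [MvPolynomial.comp_aeval_apply]
    congr 2
    exact funext hv
  choose e he using fun q : P =>
    MvPolynomial.exists_aeval_X_mul_eq (Q q) m (fun l hl => ih l hl q) u
  have hsum := congrArg θ hQ
  simp only [map_sum, map_mul, hθf, he, map_zero] at hsum
  have hsum' : ∑ q : P, θ (h q) *
      (MvPolynomial.aeval u (MvPolynomial.homogeneousComponent m (Q q)) + X * e q) = 0 := by
    refine (mul_eq_zero.1 ?_).resolve_left
      (pow_ne_zero m (Polynomial.X_ne_zero : (X : Polynomial L) ≠ 0))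
    rw [Finset.mul_sum, ← hsum]
    exact Finset.sum_congr rfl fun q _ => by ring
  have hev (g : σ → Polynomial L) (q : MvPolynomial σ L) :
      Polynomial.eval 0 (MvPolynomial.aeval g q) =
        MvPolynomial.eval (fun k => Polynomial.eval 0 (g k)) q := by
    rw [← Polynomial.coe_aeval_eq_eval, MvPolynomial.comp_aeval_apply,
      MvPolynomial.aeval_eq_eval]
  have := congrArg (Polynomial.eval 0) hsum'
  simp only [Polynomial.eval_finsetSum, Polynomial.eval_mul, Polynomial.eval_add,
    Polynomial.eval_X, zero_mul, add_zero, Polynomial.eval_zero, θ, hev, u,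
    Polynomial.eval_C] at this
  rw [Finset.sum_eq_single p (fun q _ hq => by rw [h0 q p hq.symm, zero_mul])
    (by simp), h1, one_mul] at this
  rw [this, map_zero]

theorem MvPolynomial.finrank_restrictDegree (R : ℕ) :
    Module.finrank L (MvPolynomial.restrictDegree σ L R) = (R + 1) ^ Fintype.card σ := by
  classical
  refine (Module.finrank_eq_nat_card_basis
    (MvPolynomial.basisRestrictSupport L {n : σ →₀ ℕ | ∀ i, n i ≤ R})).trans ?_
  let e : {n : σ →₀ ℕ | ∀ i, n i ≤ R} ≃ (σ → Fin (R + 1)) :=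
    { toFun := fun n i => ⟨n.1 i, Nat.lt_succ_of_le (n.2 i)⟩
      invFun := fun g => ⟨Finsupp.equivFunOnFinite.symm fun i => (g i).1,
        fun i => Nat.le_of_lt_succ (g i).2⟩
      left_inv := fun n => by ext; simp
      right_inv := fun g => by ext; simp }
  rw [Nat.card_congr e]
  simp

theorem card_le_of_isNonsingularZero [Infinite L] {d : ℕ} {f : σ → MvPolynomial σ L}
    (hd : ∀ k, (f k).totalDegree ≤ d) {P : Finset (σ → L)}
    (hP : ∀ p ∈ P, IsNonsingularZero f p) :
    P.card ≤ (Fintype.card σ * d + 1) ^ Fintype.card σ := by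
  classical
  choose h h1 h0 using fun p : P => MvPolynomial.exists_interpolation P p.1
  let H := Finset.univ.sup fun p => (h p).totalDegree
  let N := Fintype.card σ
  have hdeg (p : P) (q : MvPolynomial.restrictDegree σ L H) :
      h p * MvPolynomial.aeval f q.1 ∈ MvPolynomial.restrictDegree σ L (H + N * H * d) := by
    refine MvPolynomial.restrictTotalDegree_le_restrictDegree (R := L) σ _ ?_
    rw [MvPolynomial.mem_restrictTotalDegree]
    refine (MvPolynomial.totalDegree_mul (h p) _).trans (add_le_add
      (Finset.le_sup (f := fun p => (h p).totalDegree) (Finset.mem_univ p)) ?_)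
    rw [MvPolynomial.aeval_def, MvPolynomial.eval₂_eq' (algebraMap L (MvPolynomial σ L)) f q.1]
    refine MvPolynomial.totalDegree_finsetSum_le (R := L) fun α hα => ?_
    refine (MvPolynomial.totalDegree_mul _ _).trans ?_
    rw [MvPolynomial.algebraMap_eq, MvPolynomial.totalDegree_C, zero_add]
    refine (MvPolynomial.totalDegree_finsetProd _ _).trans ?_
    refine (Finset.sum_le_card_nsmul _ _ (H * d) fun k _ => ?_).trans_eq (by simp [N, mul_assoc])
    exact (MvPolynomial.totalDegree_pow _ _).trans
      (Nat.mul_le_mul ((MvPolynomial.mem_restrictDegree _ _ _).1 q.2 α hα k) (hd k))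
  let Ψ : (P → MvPolynomial.restrictDegree σ L H) →ₗ[L]
      MvPolynomial.restrictDegree σ L (H + N * H * d) :=
    { toFun := fun Q => ⟨∑ p, h p * MvPolynomial.aeval f (Q p).1,
        Submodule.sum_mem _ fun p _ => hdeg p (Q p)⟩
      map_add' := fun Q Q' => Subtype.ext (by simp [mul_add, Finset.sum_add_distrib])
      map_smul' := fun c Q => Subtype.ext (by simp [Finset.smul_sum]) }
  have hΨ : Function.Injective Ψ := by
    rw [← LinearMap.ker_eq_bot, LinearMap.ker_eq_bot']
    intro Q hQ
    funext p
    refine Subtype.ext (eq_zero_of_sum_mul_aeval_eq_zero hP h1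
      (fun p q hqp => h0 p q.1 q.2 (Subtype.coe_ne_coe.2 hqp)) (Q := fun p => (Q p).1) ?_ p)
    exact congrArg Subtype.val hQ
  have hle := LinearMap.finrank_le_finrank_of_injective hΨ
  rw [Module.finrank_pi_fintype, Finset.sum_const, MvPolynomial.finrank_restrictDegree,
    MvPolynomial.finrank_restrictDegree, Finset.card_univ, Fintype.card_coe, smul_eq_mul] at hle
  refine Nat.le_of_mul_le_mul_right (hle.trans ?_) (pow_pos (Nat.succ_pos H) N)
  rw [← mul_pow]
  exact Nat.pow_le_pow_left (by simp only [N]; nlinarith [Nat.zero_le (Fintype.card σ * d)]) _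

end Bezout

section SandwichMatrix

variable {n : ℕ} {R : Type*} [CommRing R]

/-- The matrix whose column `(i, j)` lists the entries of `Hᵢ Eⱼⱼ adj(Hᵢ)` if `i ≠ j`, and those of
`Eᵢᵢ` if `i = j`. -/
def sandwichMatrix (H : Fin n → Matrix (Fin n) (Fin n) R) :
    Matrix (Fin n × Fin n) (Fin n × Fin n) R :=
  Matrix.of fun ab ij => if ij.1 = ij.2 then (if ab = ij then 1 else 0)
    else H ij.1 ab.1 ij.2 * (H ij.1).adjugate ij.2 ab.2

theorem map_det_sandwichMatrix {R' : Type*} [CommRing R'] (φ : R →+* R')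
    (H : Fin n → Matrix (Fin n) (Fin n) R) :
    φ (sandwichMatrix H).det = (sandwichMatrix fun i => φ.mapMatrix (H i)).det := by
  rw [RingHom.map_det]
  congr 1
  ext ab ij
  simp only [sandwichMatrix, RingHom.mapMatrix_apply, Matrix.map_apply, Matrix.of_apply]
  rw [← RingHom.mapMatrix_apply, ← RingHom.map_adjugate, RingHom.mapMatrix_apply]
  split_ifs <;> simp

theorem det_sandwichMatrix_mem_pow {L : Type*} [Field L] [Algebra L R] {W : Submodule L R}
    (h1 : (1 : R) ∈ W) {a : ℕ} {H : Fin n → Matrix (Fin n) (Fin n) R}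
    (hH : ∀ i j k, H i j k ∈ W ^ a) :
    (sandwichMatrix H).det ∈ W ^ (n * n * (a + n * a)) := by
  have h : ∀ ab ij, sandwichMatrix H ab ij ∈ W ^ (a + n * a) := by
    intro ab ij
    rw [sandwichMatrix, Matrix.of_apply]
    split_ifs
    · simpa using Submodule.algebraMap_mem_pow h1 (a + n * a) 1
    · exact zero_mem _
    · have := Matrix.adjugate_apply_mem_pow h1 (hH ij.1) ij.2 ab.2
      rw [Fintype.card_fin] at this
      exact Submodule.mul_mem_pow (hH _ _ _) this
  simpa using Matrix.det_mem_pow h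

variable {L : Type*} [Field L]

theorem det_sandwichMatrix_smul_ne_zero_iff {c : Fin n → L} (hc : ∀ i, c i ≠ 0)
    (H : Fin n → Matrix (Fin n) (Fin n) L) :
    (sandwichMatrix fun i => c i • H i).det ≠ 0 ↔ (sandwichMatrix H).det ≠ 0 := by
  have h : (sandwichMatrix fun i => c i • H i) = Matrix.of fun ab ij =>
      (if ij.1 = ij.2 then 1 else c ij.1 * c ij.1 ^ (n - 1)) * sandwichMatrix H ab ij := by
    ext ab ij
    simp only [sandwichMatrix, Matrix.of_apply, Matrix.adjugate_smul, Matrix.smul_apply,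
      smul_eq_mul, Fintype.card_fin]
    split_ifs <;> ring
  rw [h, Matrix.det_mul_row]
  refine (mul_ne_zero_iff_left ?_)
  refine Finset.prod_ne_zero_iff.2 fun ij _ => ?_
  split_ifs
  · exact one_ne_zero
  · exact mul_ne_zero (hc _) (pow_ne_zero _ (hc _))

theorem sandwichMatrix_mulVec (H : Fin n → Matrix (Fin n) (Fin n) L) (u : Fin n × Fin n → L)
    (a b : Fin n) :
    (sandwichMatrix H).mulVec u (a, b) = (Matrix.diagonal (fun j => u (j, j)) +
      ∑ i, H i * Matrix.diagonal (fun j => if i = j then 0 else u (i, j)) *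
        (H i).adjugate) a b := by
  have hterm (i : Fin n) : ∑ j, sandwichMatrix H (a, b) (i, j) * u (i, j) =
      (if a = i ∧ b = i then u (i, i) else 0) +
      (H i * Matrix.diagonal (fun j => if i = j then 0 else u (i, j)) *
        (H i).adjugate) a b := by
    rw [Matrix.mul_apply, ← Finset.add_sum_erase _ _ (Finset.mem_univ i),
      ← Finset.add_sum_erase (a := i) _ (fun j => _ * _) (Finset.mem_univ i)]
    rw [Matrix.mul_diagonal, if_pos rfl, mul_zero, zero_mul, zero_add]
    congr 1
    · simp [sandwichMatrix]
    · refine Finset.sum_congr rfl fun j hj => ?_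
      have hij : i ≠ j := (Finset.ne_of_mem_erase hj).symm
      simp only [sandwichMatrix, Matrix.of_apply, Matrix.mul_diagonal, if_neg hij]
      ring
  rw [Matrix.mulVec, dotProduct, Fintype.sum_prod_type, Finset.sum_congr rfl fun i _ => hterm i,
    Finset.sum_add_distrib, Matrix.add_apply, Matrix.sum_apply]
  congr 1
  rw [Matrix.diagonal_apply]
  by_cases hab : a = b
  · subst hab
    simp
  · rw [if_neg hab]
    refine Finset.sum_eq_zero fun i _ => if_neg ?_
    rintro ⟨rfl, rfl⟩
    exact hab rfl

variable (L) in
/-- The unipotent matrix `1 + ∑_{b ≠ i} E_{ib}`. -/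
def rowUnipotent (i : Fin n) : Matrix (Fin n) (Fin n) L :=
  (1 : Matrix (Fin n) (Fin n) L).updateRow i 1

theorem det_rowUnipotent (i : Fin n) : (rowUnipotent L i).det = 1 := by
  rw [rowUnipotent, ← Matrix.cramer_transpose_apply, Matrix.transpose_one, Matrix.cramer_one]
  rfl

theorem adjugate_rowUnipotent {i j : Fin n} (hij : i ≠ j) (b : Fin n) :
    (rowUnipotent L i).adjugate j b = if j = b then 1 else 0 := by
  have h (b : Fin n) : ∑ k, (rowUnipotent L i).adjugate j k * rowUnipotent L i k b =
      if j = b then 1 else 0 := by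
    rw [← Matrix.mul_apply, Matrix.adjugate_mul, det_rowUnipotent, one_smul, Matrix.one_apply]
  have h' (b : Fin n) : (rowUnipotent L i).adjugate j i +
      (if b = i then 0 else (rowUnipotent L i).adjugate j b) = if j = b then 1 else 0 := by
    rw [← h b, ← Finset.add_sum_erase _ _ (Finset.mem_univ i)]
    congr 1
    · simp [rowUnipotent]
    · rw [Finset.sum_congr rfl fun k hk => by
        rw [rowUnipotent, Matrix.updateRow_ne (Finset.ne_of_mem_erase hk), Matrix.one_apply,
          mul_ite, mul_one, mul_zero]]
      rw [Finset.sum_ite_eq']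
      by_cases hb : b = i <;> simp [hb, rowUnipotent]
  have h0 : (rowUnipotent L i).adjugate j i = 0 := by simpa [hij.symm] using h' i
  by_cases hb : b = i
  · rw [hb, h0, if_neg hij.symm]
  · simpa [hb, h0] using h' b

theorem det_sandwichMatrix_rowUnipotent_ne_zero :
    (sandwichMatrix fun i : Fin n => rowUnipotent L i).det ≠ 0 := by
  intro h
  obtain ⟨u, hu, h0⟩ := Matrix.exists_mulVec_eq_zero_iff.2 h
  have hS (a b i j : Fin n) : sandwichMatrix (fun i : Fin n => rowUnipotent L i) (a, b) (i, j) =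
      if i = j then (if a = i ∧ b = i then 1 else 0)
      else if b = j ∧ (a = i ∨ a = j) then 1 else 0 := by
    simp only [sandwichMatrix, Matrix.of_apply]
    by_cases hij : i = j
    · simp [hij]
    · rw [if_neg hij, if_neg hij, adjugate_rowUnipotent hij, rowUnipotent, Matrix.updateRow_apply,
        Matrix.one_apply, Pi.one_apply]
      grind
  have hsum (a b : Fin n) : ∑ i, ∑ j, sandwichMatrix (fun i : Fin n => rowUnipotent L i)
      (a, b) (i, j) * u (i, j) = 0 := by
    rw [← Fintype.sum_prod_type']
    exact congrFun h0 (a, b)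
  have hoff : ∀ a b, a ≠ b → u (a, b) = 0 := by
    intro a b hab
    have := hsum a b
    rw [Finset.sum_eq_single a, Finset.sum_eq_single b] at this
    · simpa [hS, hab] using this
    · intro j _ hj
      rw [hS, if_neg (by grind : ¬ (b = j ∧ (a = a ∨ a = j)))]
      grind
    · simp
    · intro i _ hi
      refine Finset.sum_eq_zero fun j _ => ?_
      rw [hS]
      grind
    · simp
  refine hu (funext fun ⟨a, b⟩ => ?_)
  by_cases hab : a = b
  · subst hab
    have := hsum a a
    rw [Finset.sum_eq_single a, Finset.sum_eq_single a] at this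
    · simpa [hS] using this
    · intro j _ hj
      rw [hoff a j hj.symm, mul_zero]
    · simp
    · intro i _ hi
      refine Finset.sum_eq_zero fun j _ => ?_
      by_cases hij : i = j
      · rw [hS]
        grind
      · rw [hoff i j hij, mul_zero]
    · simp
  · exact hoff a b hab

end SandwichMatrix

section Density

open Matrix

/-- The diagonal matrix with entry `1` at `j₀` and `x` elsewhere. -/
def diagonalOneAt {n : ℕ} {R : Type*} [CommRing R] (j₀ : Fin n) (x : R) :
    Matrix (Fin n) (Fin n) R :=
  diagonal fun j => if j = j₀ then 1 else x

theorem exists_specialLinearGroup_det_sandwichMatrix_ne_zero {n : ℕ} (hn : 0 < n) {K L : Type*}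
    [Field K] [Fintype K] [Field L] [Algebra K L]
    (hK : n * n * ((n + 1) + n * (n + 1)) + n * n < Fintype.card K)
    (γ : (Matrix (Fin n) (Fin n) L)ˣ) :
    ∃ h : Fin n → SpecialLinearGroup (Fin n) K,
      (sandwichMatrix fun i => (γ⁻¹).1 * (algebraMap K L).mapMatrix (h i).1 * γ.1).det ≠ 0 := by
  classical
  let j₀ : Fin n := ⟨0, hn⟩
  let σ := Fin n × Fin n × Fin n
  let c : L →+* MvPolynomial σ L := algebraMap L (MvPolynomial σ L)
  let Y : Fin n → Matrix (Fin n) (Fin n) (MvPolynomial σ L) := fun i =>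
    Matrix.of fun a b => MvPolynomial.X (i, a, b)
  let H : Fin n → Matrix (Fin n) (Fin n) (MvPolynomial σ L) := fun i =>
    c.mapMatrix (γ⁻¹).1 * (Y i * diagonalOneAt j₀ (Y i).det) * c.mapMatrix γ.1
  let p : MvPolynomial σ L := (sandwichMatrix H).det * ∏ i, (Y i).det
  have heval (x : σ → L) : MvPolynomial.eval x p =
      (sandwichMatrix fun i => (γ⁻¹).1 * ((Matrix.of fun a b => x (i, a, b)) *
        diagonalOneAt j₀ (Matrix.of fun a b => x (i, a, b)).det) * γ.1).det *
      ∏ i, (Matrix.of fun a b => x (i, a, b)).det := by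
    have hY (i : Fin n) : (MvPolynomial.eval x).mapMatrix (Y i) =
        Matrix.of fun a b => x (i, a, b) := by
      ext a b
      simp [Y]
    have hc (M : Matrix (Fin n) (Fin n) L) :
        (MvPolynomial.eval x).mapMatrix (c.mapMatrix M) = M := by
      ext a b
      simp [c, MvPolynomial.algebraMap_eq]
    have hd (y : MvPolynomial σ L) : (MvPolynomial.eval x).mapMatrix (diagonalOneAt j₀ y) =
        diagonalOneAt j₀ (MvPolynomial.eval x y) := by
      ext a b
      simp only [diagonalOneAt, RingHom.mapMatrix_apply, map_apply, diagonal_apply]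
      split_ifs <;> simp
    rw [map_mul, map_det_sandwichMatrix, map_prod]
    simp only [H, map_mul, hc, hd, hY, RingHom.map_det]
  have hdeg : p.totalDegree ≤ n * n * ((n + 1) + n * (n + 1)) + n * n := by
    have h1 := one_mem_degreeOneSpan (σ := σ) (L := L)
    have hY : ∀ i a b, Y i a b ∈ degreeOneSpan σ L ^ 1 := fun i a b => by
      rw [pow_one]
      exact X_mem_degreeOneSpan _
    have hdet (i : Fin n) : (Y i).det ∈ degreeOneSpan σ L ^ n := by
      simpa using det_mem_pow (hY i)
    have hdiag (i : Fin n) : ∀ a b, diagonalOneAt j₀ (Y i).det a b ∈ degreeOneSpan σ L ^ n := by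
      intro a b
      rw [diagonalOneAt, diagonal_apply]
      split_ifs
      · simpa using Submodule.algebraMap_mem_pow h1 n 1
      · exact hdet i
      · exact zero_mem _
    have hH : ∀ i a b, H i a b ∈ degreeOneSpan σ L ^ (n + 1) := by
      intro i
      have := mul_apply_mem_pow (mul_apply_mem_pow (map_algebraMap_mem_pow h1 0 (γ⁻¹).1)
        (mul_apply_mem_pow (hY i) (hdiag i))) (map_algebraMap_mem_pow h1 0 γ.1)
      rwa [show 0 + (1 + n) + 0 = n + 1 by ring] at this
    refine totalDegree_le_of_mem_degreeOneSpan_pow (Submodule.mul_mem_pow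
      (det_sandwichMatrix_mem_pow h1 hH) ?_)
    simpa using Submodule.prod_mem_pow_mul Finset.univ fun i _ => hdet i
  have hp : p ≠ 0 := by
    intro h0
    have hcong := heval fun k => (γ.1 * rowUnipotent L k.1 * (γ⁻¹).1) k.2.1 k.2.2
    have hof (i : Fin n) : (Matrix.of fun a b => (γ.1 * rowUnipotent L i * (γ⁻¹).1) a b) =
        γ.1 * rowUnipotent L i * (γ⁻¹).1 := rfl
    have hdet (i : Fin n) : (γ.1 * rowUnipotent L i * (γ⁻¹).1).det = 1 := by
      rw [det_mul, det_mul, det_rowUnipotent, mul_one, ← det_mul, Units.mul_inv, det_one]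
    have hone : diagonalOneAt j₀ (1 : L) = 1 := by simp [diagonalOneAt]
    have hconj (i : Fin n) : (γ⁻¹).1 * (γ.1 * rowUnipotent L i * (γ⁻¹).1) * γ.1 =
        rowUnipotent L i := by
      simp [mul_assoc]
    simp only [hof, hdet, hone, mul_one, hconj, Finset.prod_const_one, h0, map_zero] at hcong
    exact det_sandwichMatrix_rowUnipotent_ne_zero hcong.symm
  obtain ⟨y, hy⟩ : ∃ y : σ → K, MvPolynomial.eval (fun k => algebraMap K L (y k)) p ≠ 0 := by
    by_contra! hc
    refine hp (MvPolynomial.eq_zero_of_eval_zero_at_prod_finset p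
      (fun _ => Finset.univ.image (algebraMap K L)) (fun k => ?_) fun x hx => ?_)
    · rw [Finset.card_image_of_injective _ (algebraMap K L).injective, Finset.card_univ]
      exact ((MvPolynomial.degreeOf_le_totalDegree p k).trans hdeg).trans_lt hK
    · choose y hy using fun k => Finset.mem_image.1 (hx k)
      obtain rfl : (fun k => algebraMap K L (y k)) = x := funext fun k => (hy k).2
      exact hc y
  rw [heval] at hy
  let M : Fin n → Matrix (Fin n) (Fin n) K := fun i => Matrix.of fun a b => y (i, a, b)
  have hM (i : Fin n) : (Matrix.of fun a b => algebraMap K L (y (i, a, b))) =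
      (algebraMap K L).mapMatrix (M i) := rfl
  simp only [hM, ← RingHom.map_det] at hy
  have hδ (i : Fin n) : (M i).det ≠ 0 := fun h0 =>
    Finset.prod_ne_zero_iff.1 (right_ne_zero_of_mul hy) i (Finset.mem_univ i) (by rw [h0, map_zero])
  refine ⟨fun i => ⟨M i * diagonal fun j => if j = j₀ then (M i).det⁻¹ else 1, ?_⟩, ?_⟩
  · rw [det_mul, det_diagonal, Finset.prod_ite_eq' , if_pos (Finset.mem_univ _),
      mul_inv_cancel₀ (hδ i)]
  · refine (det_sandwichMatrix_smul_ne_zero_iff (c := fun i => algebraMap K L (M i).det)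
      (fun i => (map_ne_zero _).2 (hδ i)) _).1 ?_
    convert left_ne_zero_of_mul hy using 4 with i
    rw [map_mul, ← smul_mul_assoc, ← mul_smul_comm, ← mul_smul_comm]
    congr 3
    have := (map_ne_zero (algebraMap K L)).2 (hδ i)
    ext a b
    simp only [diagonalOneAt, RingHom.mapMatrix_apply, Matrix.map_apply, Matrix.smul_apply,
      diagonal_apply, smul_eq_mul]
    split_ifs <;> simp [this]

end Density

section Escape

open Matrix

theorem Submodule.finrank_span_finset_pow_le {L R : Type*} [Field L] [CommRing R] [Algebra L R]
    (s : Finset R) (D : ℕ) :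
    Module.finrank L ↥(Submodule.span L (s : Set R) ^ D) ≤ s.card ^ D := by
  classical
  rw [Submodule.span_pow, ← Finset.coe_pow]
  exact (finrank_span_finset_le_card _).trans Finset.card_pow_le

variable {n : ℕ} {K : Type*} [Field K]

/-- The alternating product of `t₀`, `g 0`, `t 0`, `g 1`, up to and including `g i`. -/
def altProd {M : Type*} [Monoid M] (t₀ : M) (t g : Fin n → M) (i : Fin n) : M :=
  t₀ * Fin.partialProd (fun i => g i * t i) i.castSucc * g i

theorem map_partialProd {M N F : Type*} [Monoid M] [Monoid N] [FunLike F M N]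
    [MonoidHomClass F M N] (φ : F) (u : Fin n → M)
    (k : Fin (n + 1)) : φ (Fin.partialProd u k) = Fin.partialProd (fun i => φ (u i)) k := by
  induction k using Fin.induction with
  | zero => simp
  | succ k ih => rw [Fin.partialProd_succ, Fin.partialProd_succ, map_mul, ih]

theorem map_altProd {M N F : Type*} [Monoid M] [Monoid N] [FunLike F M N]
    [MonoidHomClass F M N] (φ : F) (t₀ : M)
    (t g : Fin n → M) (i : Fin n) :
    φ (altProd t₀ t g i) = altProd (φ t₀) (fun i => φ (t i)) (fun i => φ (g i)) i := by
  simp [altProd, map_partialProd]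

theorem exists_altProd_eq {G : Type*} [Group G] (t₀ : G) (t h : Fin n → G) :
    ∃ g, altProd t₀ t g = h := by
  let Q : Fin (n + 1) → G := Fin.cons t₀ fun i => h i * t i
  have hQ (k : Fin (n + 1)) :
      t₀ * Fin.partialProd (fun i => (Q i.castSucc)⁻¹ * h i * t i) k = Q k := by
    induction k using Fin.induction with
    | zero => simp [Q]
    | succ k ih =>
      rw [Fin.partialProd_succ, ← mul_assoc, ih]
      simp [Q, mul_assoc]
  refine ⟨fun i => (Q i.castSucc)⁻¹ * h i, funext fun i => ?_⟩
  rw [altProd, hQ, mul_inv_cancel_left]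

variable (n K) in
/-- The functions on `SL_n(K)ⁿ` spanned by `1` and by the matrix entries. -/
noncomputable def entrySpan (L : Type*) [Field L] [Algebra K L] :
    Submodule L ((Fin n → SpecialLinearGroup (Fin n) K) → L) :=
  Submodule.span L (insert 1 (Set.range fun (k : Fin n × Fin n × Fin n) g =>
    algebraMap K L ((g k.1).1 k.2.1 k.2.2)))

variable {L : Type*} [Field L] [Algebra K L]

theorem one_mem_entrySpan : 1 ∈ entrySpan n K L :=
  Submodule.subset_span (Set.mem_insert _ _)

theorem entry_mem_entrySpan (i a b : Fin n) :
    (fun g => algebraMap K L ((g i).1 a b)) ∈ entrySpan n K L :=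
  Submodule.subset_span (Set.mem_insert_of_mem _ ⟨(i, a, b), rfl⟩)

theorem finrank_entrySpan_pow_le (D : ℕ) :
    Module.finrank L ↥(entrySpan n K L ^ D) ≤ (n * n * n + 1) ^ D := by
  classical
  let s : Finset ((Fin n → SpecialLinearGroup (Fin n) K) → L) :=
    insert 1 (Finset.univ.image fun (k : Fin n × Fin n × Fin n) g =>
      algebraMap K L ((g k.1).1 k.2.1 k.2.2))
  have hs : entrySpan n K L = Submodule.span L (s : Set _) := by
    simp [entrySpan, s]
  rw [hs]
  refine (Submodule.finrank_span_finset_pow_le s D).trans (Nat.pow_le_pow_left ?_ D)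
  refine (Finset.card_insert_le _ _).trans (Nat.add_le_add_right (Finset.card_image_le.trans ?_) 1)
  simp [mul_assoc]

theorem comp_mul_left_mem_entrySpan_pow (s : Fin n → SpecialLinearGroup (Fin n) K) {D : ℕ}
    {f : (Fin n → SpecialLinearGroup (Fin n) K) → L} (hf : f ∈ entrySpan n K L ^ D) :
    (fun g => f (s * g)) ∈ entrySpan n K L ^ D := by
  let φ : ((Fin n → SpecialLinearGroup (Fin n) K) → L) →ₐ[L]
      ((Fin n → SpecialLinearGroup (Fin n) K) → L) :=
    AlgHom.pi fun g => Pi.evalAlgHom L _ (s * g)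
  have hφ : (entrySpan n K L).map φ.toLinearMap ≤ entrySpan n K L := by
    rw [entrySpan, Submodule.map_span, Submodule.span_le]
    rintro _ ⟨_, rfl | ⟨⟨i, a, b⟩, rfl⟩, rfl⟩
    · exact one_mem_entrySpan
    · have : φ (fun g => algebraMap K L ((g i).1 a b)) =
          ∑ c, algebraMap K L ((s i).1 a c) • fun g => algebraMap K L ((g i).1 c b) := by
        ext g
        simp [φ, Matrix.mul_apply, Algebra.smul_def]
      change φ (fun g => algebraMap K L ((g i).1 a b)) ∈ entrySpan n K L
      rw [this]
      exact Submodule.sum_mem _ fun c _ => Submodule.smul_mem _ _ (entry_mem_entrySpan i c b)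
  have := Submodule.mem_map_of_mem (f := φ.toLinearMap) hf
  rw [Submodule.map_pow] at this
  exact pow_le_pow_left₀ zero_le hφ D this

theorem det_sandwichMatrix_altProd_mem (γ : (Matrix (Fin n) (Fin n) L)ˣ)
    (t₀ : SpecialLinearGroup (Fin n) K) (t : Fin n → SpecialLinearGroup (Fin n) K) :
    (fun g => (sandwichMatrix fun i => (γ⁻¹).1 *
      (algebraMap K L).mapMatrix (altProd t₀ t g i).1 * γ.1).det) ∈
      entrySpan n K L ^ (n * n * (n + n * n)) := by
  let R := (Fin n → SpecialLinearGroup (Fin n) K) → L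
  let c : L →+* R := algebraMap L R
  let X : Fin n → Matrix (Fin n) (Fin n) R := fun i => Matrix.of fun a b g =>
    algebraMap K L ((g i).1 a b)
  let T (x : SpecialLinearGroup (Fin n) K) : Matrix (Fin n) (Fin n) R :=
    c.mapMatrix ((algebraMap K L).mapMatrix x.1)
  let H : Fin n → Matrix (Fin n) (Fin n) R := fun i =>
    c.mapMatrix (γ⁻¹).1 * altProd (T t₀) (fun i => T (t i)) X i * c.mapMatrix γ.1
  have hH : ∀ i a b, H i a b ∈ entrySpan n K L ^ n := by
    intro i
    have h1 : 1 ∈ entrySpan n K L := one_mem_entrySpan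
    have hX : ∀ i a b, X i a b ∈ entrySpan n K L ^ 1 := fun i a b => by
      rw [pow_one]
      exact entry_mem_entrySpan i a b
    have hXT (i) := mul_apply_mem_pow (hX i) (map_algebraMap_mem_pow h1 0
      ((algebraMap K L).mapMatrix (t i).1))
    have := mul_apply_mem_pow (mul_apply_mem_pow (map_algebraMap_mem_pow h1 0 (γ⁻¹).1)
      (mul_apply_mem_pow (mul_apply_mem_pow (map_algebraMap_mem_pow h1 0
        ((algebraMap K L).mapMatrix t₀.1)) (partialProd_apply_mem_pow h1 hXT i.castSucc)) (hX i)))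
      (map_algebraMap_mem_pow h1 0 γ.1)
    exact fun a b => Submodule.pow_le_pow_of_one_mem h1 (by simp) (this a b)
  convert det_sandwichMatrix_mem_pow one_mem_entrySpan hH using 1
  ext g
  have hc (M : Matrix (Fin n) (Fin n) L) : (Pi.evalRingHom _ g).mapMatrix (c.mapMatrix M) = M := by
    ext a b
    rfl
  have hX (i : Fin n) : (Pi.evalRingHom _ g).mapMatrix (X i) =
      (algebraMap K L).mapMatrix (g i).1 := by
    ext a b
    rfl
  let ψ : SpecialLinearGroup (Fin n) K →* Matrix (Fin n) (Fin n) L :=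
    { toFun := fun x => (algebraMap K L).mapMatrix x.1
      map_one' := by simp
      map_mul' := by simp }
  have hp (i : Fin n) : (algebraMap K L).mapMatrix (altProd t₀ t g i).1 =
      altProd ((algebraMap K L).mapMatrix t₀.1) (fun i => (algebraMap K L).mapMatrix (t i).1)
        (fun i => (algebraMap K L).mapMatrix (g i).1) i :=
    map_altProd ψ t₀ t g i
  have hp' (i : Fin n) : (Pi.evalRingHom _ g).mapMatrix
      (altProd (T t₀) (fun i => T (t i)) X i) = altProd
        ((Pi.evalRingHom _ g).mapMatrix (T t₀)) (fun i => (Pi.evalRingHom _ g).mapMatrix (T (t i)))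
        (fun i => (Pi.evalRingHom _ g).mapMatrix (X i)) i :=
    map_altProd (Pi.evalRingHom (fun _ => L) g).mapMatrix _ _ _ i
  change _ = Pi.evalRingHom _ g (sandwichMatrix H).det
  rw [map_det_sandwichMatrix]
  simp only [H, T, map_mul, hc, hp, hp', hX]

theorem exists_finset_det_sandwichMatrix_altProd_ne_zero (hn : 0 < n) [Fintype K]
    (hK : n * n * ((n + 1) + n * (n + 1)) + n * n < Fintype.card K)
    (γ : (Matrix (Fin n) (Fin n) L)ˣ) {S : Set (SpecialLinearGroup (Fin n) K)} (h1 : 1 ∈ S)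
    (hS : ∀ g, ∃ k, g ∈ S ^ k) {m : ℕ} (hm : m = (n * n * n + 1) ^ (n * n * (n + n * n))) :
    ∃ E : Finset (Fin n → SpecialLinearGroup (Fin n) K), E.card ≤ m ∧
      (∀ g ∈ E, ∀ i, g i ∈ S ^ m) ∧ ∀ t₀ t, ∃ g ∈ E, (sandwichMatrix fun i => (γ⁻¹).1 *
        (algebraMap K L).mapMatrix (altProd t₀ t g i).1 * γ.1).det ≠ 0 := by
  let S' : Set (Fin n → SpecialLinearGroup (Fin n) K) := Set.pi Set.univ fun _ => S
  have hmem (k : ℕ) (g : Fin n → SpecialLinearGroup (Fin n) K) :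
      g ∈ S' ^ k ↔ ∀ i, g i ∈ S ^ k := by
    induction k generalizing g with
    | zero => simp [funext_iff]
    | succ k ih =>
      simp only [pow_succ, Set.mem_mul]
      constructor
      · rintro ⟨a, ha, b, hb, rfl⟩ i
        exact ⟨a i, (ih a).1 ha i, b i, hb i trivial, rfl⟩
      · intro h
        choose a ha b hb hab using h
        exact ⟨a, (ih a).2 ha, b, fun i _ => hb i, funext hab⟩
  let W := entrySpan n K L ^ (n * n * (n + n * n))
  have hW : Module.finrank L W ≤ m := (finrank_entrySpan_pow_le _).trans_eq hm.symm
  obtain ⟨E, hE, hES, hdet⟩ := exists_finset_determining (S := S' ^ m) m W hW fun f hf h0 =>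
    eq_zero_of_vanishes_on_pow W hW (S := S') (fun _ _ => h1) (fun g => by
      choose k hk using fun i => hS (g i)
      refine ⟨Finset.univ.sup k, (hmem _ _).2 fun i => ?_⟩
      exact Set.pow_subset_pow_right h1 (Finset.le_sup (Finset.mem_univ i)) (hk i))
      (fun s _ f hf => comp_mul_left_mem_entrySpan_pow s hf) hf h0
  refine ⟨E, hE, fun g hg => (hmem m g).1 (hES hg), fun t₀ t => ?_⟩
  by_contra! h0
  have := hdet _ (det_sandwichMatrix_altProd_mem γ t₀ t) h0
  obtain ⟨h, hh⟩ := exists_specialLinearGroup_det_sandwichMatrix_ne_zero hn hK γ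
  obtain ⟨g, rfl⟩ := exists_altProd_eq t₀ t h
  exact hh (congrFun this g)

end Escape

section Chain

open Matrix

theorem isUnit_partialProd {M : Type*} [Monoid M] {n : ℕ} {u : Fin n → M} (hu : ∀ i, IsUnit (u i))
    (k : Fin (n + 1)) : IsUnit (Fin.partialProd u k) := by
  induction k using Fin.induction with
  | zero => simp
  | succ k ih =>
    rw [Fin.partialProd_succ]
    exact ih.mul (hu k)

theorem isUnit_altProd {M : Type*} [Monoid M] {n : ℕ} {t₀ : M} {t g : Fin n → M}
    (ht₀ : IsUnit t₀) (ht : ∀ i, IsUnit (t i)) (hg : ∀ i, IsUnit (g i)) (i : Fin n) :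
    IsUnit (altProd t₀ t g i) :=
  (ht₀.mul (isUnit_partialProd (fun j => (hg j).mul (ht j)) _)).mul (hg i)

/-- First-order expansion of an alternating product in which the factors `t₀` and `t i` are
perturbed to `(1 + x e₀) t₀` and `(1 + x eᵢ) tᵢ`. -/
theorem exists_first_order_expansion {S A : Type*} [CommRing S] [Ring A] [Algebra S A] {n : ℕ}
    (x : S) (t₀ e₀ : A) (t g e h : Fin n → A) (hh : ∀ i, h i * altProd t₀ t g i = 1)
    (k : Fin (n + 1)) :
    ∃ r : A, (1 + x • e₀) * t₀ * Fin.partialProd (fun i => g i * ((1 + x • e i) * t i)) k =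
      (1 + x • (e₀ + Fin.partialSum (fun i => altProd t₀ t g i * e i * h i) k)) *
        (t₀ * Fin.partialProd (fun i => g i * t i) k) + x ^ 2 • r := by
  induction k using Fin.induction with
  | zero => exact ⟨0, by simp⟩
  | succ k ih =>
    obtain ⟨r, hr⟩ := ih
    have hk := hh k
    rw [Fin.partialProd_succ, Fin.partialProd_succ, Fin.partialSum_succ, ← mul_assoc, hr]
    simp only [altProd] at hk ⊢
    set Q := t₀ * Fin.partialProd (fun i => g i * t i) k.castSucc
    set Z := e₀ + Fin.partialSum (fun i => t₀ * Fin.partialProd (fun i => g i * t i) i.castSucc *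
      g i * e i * h i) k.castSucc with hZ
    have hQ : t₀ * (Fin.partialProd (fun i => g i * t i) k.castSucc * (g k * t k)) =
      Q * g k * t k := by simp only [Q, mul_assoc]
    rw [hQ, ← add_assoc, ← hZ]
    have hc : Q * g k * e k * h k * (Q * g k * t k) = Q * g k * e k * t k := by
      rw [← mul_assoc (Q * g k * e k * h k) (Q * g k) (t k),
        mul_assoc (Q * g k * e k) (h k) (Q * g k), hk, mul_one]
    refine ⟨Z * Q * g k * e k * t k + r * g k * ((1 + x • e k) * t k), ?_⟩
    have hkey : (1 + x • (Z + Q * g k * e k * h k)) * (Q * g k * t k) =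
        (1 + x • Z) * (Q * g k * t k) + x • (Q * g k * e k * t k) := by
      rw [smul_add, ← add_assoc, add_mul, smul_mul_assoc x (Q * g k * e k * h k), hc]
    rw [hkey]
    simp only [add_mul, mul_add, one_mul, smul_mul_assoc, mul_smul_comm, smul_add, mul_assoc,
      smul_smul, pow_two]
    abel

variable {n : ℕ}

/-- The diagonal matrix with entries `y (a, a)`. -/
def mainDiag {R : Type*} [CommRing R] (y : Fin n × Fin n → R) : Matrix (Fin n) (Fin n) R :=
  diagonal fun a => y (a, a)

/-- The diagonal matrix with entries `y (i, j)`, normalised to have `i`-th entry `1`. -/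
def sideDiag {R : Type*} [CommRing R] (y : Fin n × Fin n → R) (i : Fin n) :
    Matrix (Fin n) (Fin n) R :=
  diagonal fun j => if i = j then 1 else y (i, j)

/-- The alternating product of the matrices `p i` and diagonal matrices parametrised by `y`. -/
def diagChain {R : Type*} [CommRing R] (p : Fin n → Matrix (Fin n) (Fin n) R)
    (y : Fin n × Fin n → R) : Matrix (Fin n) (Fin n) R :=
  mainDiag y * Fin.partialProd (fun i => p i * sideDiag y i) (Fin.last n)

theorem mapMatrix_diagChain {R S : Type*} [CommRing R] [CommRing S] (φ : R →+* S)
    (p : Fin n → Matrix (Fin n) (Fin n) R) (y : Fin n × Fin n → R) :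
    φ.mapMatrix (diagChain p y) = diagChain (fun i => φ.mapMatrix (p i)) fun k => φ (y k) := by
  have hm : φ.mapMatrix (mainDiag y) = mainDiag fun k => φ (y k) := by
    simp [mainDiag, diagonal_map]
  have hs (i : Fin n) : φ.mapMatrix (sideDiag y i) = sideDiag (fun k => φ (y k)) i := by
    simp [sideDiag, diagonal_map, apply_ite φ]
  simp only [diagChain, map_mul, map_partialProd, hm, hs]

variable {L : Type*} [Field L]

/-- The polynomials whose common zeros are the `y` with `diagChain p y = x`. -/
noncomputable def chainPolynomial (p : Fin n → Matrix (Fin n) (Fin n) L)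
    (x : Matrix (Fin n) (Fin n) L) (k : Fin n × Fin n) : MvPolynomial (Fin n × Fin n) L :=
  diagChain (fun i => MvPolynomial.C.mapMatrix (p i)) MvPolynomial.X k.1 k.2 -
    MvPolynomial.C (x k.1 k.2)

theorem totalDegree_chainPolynomial_le (p : Fin n → Matrix (Fin n) (Fin n) L)
    (x : Matrix (Fin n) (Fin n) L) (k : Fin n × Fin n) :
    (chainPolynomial p x k).totalDegree ≤ n + 1 := by
  have h1 := one_mem_degreeOneSpan (σ := Fin n × Fin n) (L := L)
  have hX (k : Fin n × Fin n) : MvPolynomial.X k ∈ degreeOneSpan (Fin n × Fin n) L ^ 1 := by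
    rw [pow_one]
    exact X_mem_degreeOneSpan k
  have hm : ∀ a b, mainDiag MvPolynomial.X a b ∈ degreeOneSpan (Fin n × Fin n) L ^ 1 := by
    intro a b
    rw [mainDiag, diagonal_apply]
    split_ifs
    exacts [hX _, zero_mem _]
  have hs : ∀ i a b, sideDiag MvPolynomial.X i a b ∈ degreeOneSpan (Fin n × Fin n) L ^ 1 := by
    intro i a b
    rw [sideDiag, diagonal_apply]
    split_ifs
    exacts [by simpa using h1, hX _, zero_mem _]
  have hc := mul_apply_mem_pow hm (partialProd_apply_mem_pow h1 (fun i => mul_apply_mem_pow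
    (map_algebraMap_mem_pow h1 0 (p i)) (hs i)) (Fin.last n))
  refine totalDegree_le_of_mem_degreeOneSpan_pow (sub_mem ?_
    (Submodule.algebraMap_mem_pow h1 (n + 1) _))
  have := hc k.1 k.2
  simpa [diagChain, add_comm] using this

theorem isUnit_mainDiag {y : Fin n × Fin n → L} (hy : ∀ k, y k ≠ 0) : IsUnit (mainDiag y) := by
  rw [isUnit_iff_isUnit_det, mainDiag, det_diagonal, isUnit_iff_ne_zero]
  exact Finset.prod_ne_zero_iff.2 fun a _ => hy _

theorem isUnit_sideDiag {y : Fin n × Fin n → L} (hy : ∀ k, y k ≠ 0) (i : Fin n) :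
    IsUnit (sideDiag y i) := by
  rw [isUnit_iff_isUnit_det, sideDiag, det_diagonal, isUnit_iff_ne_zero]
  refine Finset.prod_ne_zero_iff.2 fun a _ => ?_
  split_ifs
  exacts [one_ne_zero, hy _]

theorem isNonsingularZero_chainPolynomial {p : Fin n → Matrix (Fin n) (Fin n) L}
    (hp : ∀ i, IsUnit (p i)) {y : Fin n × Fin n → L} (hy : ∀ k, y k ≠ 0)
    (hdet : (sandwichMatrix (altProd (mainDiag y) (sideDiag y) p)).det ≠ 0) :
    IsNonsingularZero (chainPolynomial p (diagChain p y)) y := by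
  intro w
  let c : Matrix (Fin n) (Fin n) L →+* Matrix (Fin n) (Fin n) (Polynomial L) :=
    Polynomial.C.mapMatrix
  set h := altProd (mainDiag y) (sideDiag y) p with hh
  have hunit (i : Fin n) : (h i).det ≠ 0 := by
    rw [← isUnit_iff_ne_zero, ← isUnit_iff_isUnit_det]
    exact isUnit_altProd (isUnit_mainDiag hy) (isUnit_sideDiag hy) hp i
  have hchain : IsUnit (diagChain p y).det := by
    rw [← isUnit_iff_isUnit_det]
    exact (isUnit_mainDiag hy).mul (isUnit_partialProd (fun i => (hp i).mul
      (isUnit_sideDiag hy i)) _)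
  let w' : Matrix (Fin n) (Fin n) L := Matrix.of fun a b => w (a, b)
  let Z := w' * (diagChain p y)⁻¹
  obtain ⟨u, hu⟩ : ∃ u, (sandwichMatrix h).mulVec u = fun k => Z k.1 k.2 :=
    ⟨(sandwichMatrix h)⁻¹.mulVec fun k => Z k.1 k.2, by
      rw [mulVec_mulVec, mul_nonsing_inv _ (isUnit_iff_ne_zero.2 hdet), one_mulVec]⟩
  let e₀ : Matrix (Fin n) (Fin n) L := diagonal fun j => u (j, j)
  let e : Fin n → Matrix (Fin n) (Fin n) L := fun i =>
    diagonal fun j => if i = j then 0 else (h i).det * u (i, j)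
  let h' : Fin n → Matrix (Fin n) (Fin n) L := fun i => (h i).det⁻¹ • (h i).adjugate
  have hterm (i : Fin n) : h i * e i * h' i =
      h i * diagonal (fun j => if i = j then 0 else u (i, j)) * (h i).adjugate := by
    have : e i = (h i).det • diagonal fun j => if i = j then 0 else u (i, j) := by
      ext a b
      simp [e, diagonal_apply]
    rw [this]
    simp only [h', mul_smul_comm, smul_mul_assoc, smul_smul]
    rw [inv_mul_cancel₀ (hunit i), one_smul]
  have hZ : e₀ + ∑ i, h i * e i * h' i = Z := by
    ext a b
    rw [Finset.sum_congr rfl fun i _ => hterm i, ← sandwichMatrix_mulVec, hu]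
  let v : Fin n × Fin n → L := fun k =>
    if k.1 = k.2 then u k * y k else (h k.1).det * u k * y k
  let z : Fin n × Fin n → Polynomial L := fun k =>
    Polynomial.C (y k) + Polynomial.X * Polynomial.C (v k)
  have hmain : mainDiag z = (1 + (Polynomial.X : Polynomial L) • c e₀) * c (mainDiag y) := by
    ext a b : 1
    simp only [mainDiag, e₀, c, RingHom.mapMatrix_apply, diagonal_map, map_zero, add_mul, one_mul,
      smul_mul_assoc, diagonal_mul_diagonal, Matrix.add_apply, Matrix.smul_apply, diagonal_apply]
    split_ifs
    · simp [z, v]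
      ring
    · simp
  have hside (i : Fin n) : sideDiag z i =
      (1 + (Polynomial.X : Polynomial L) • c (e i)) * c (sideDiag y i) := by
    ext a b : 1
    simp only [sideDiag, e, c, RingHom.mapMatrix_apply, diagonal_map, map_zero, add_mul, one_mul,
      smul_mul_assoc, diagonal_mul_diagonal, Matrix.add_apply, Matrix.smul_apply, diagonal_apply]
    split_ifs with hab hia
    · simp
    · simp [hia, z, v]
      ring
    · simp
  obtain ⟨r, hr⟩ := exists_first_order_expansion (Polynomial.X : Polynomial L) (c (mainDiag y))
    (c e₀) (fun i => c (sideDiag y i)) (fun i => c (p i)) (fun i => c (e i)) (fun i => c (h' i))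
    (fun i => by
      rw [← map_altProd, ← map_mul, ← hh]
      simp [h', adjugate_mul, smul_smul, inv_mul_cancel₀ (hunit i)]) (Fin.last n)
  have hsum (f : Fin n → Matrix (Fin n) (Fin n) (Polynomial L)) :
      Fin.partialSum f (Fin.last n) = ∑ i, f i := by
    rw [Fin.partialSum, List.take_of_length_le (by simp), List.sum_ofFn]
  have hexp : diagChain (fun i => c (p i)) z =
      c (diagChain p y) + (Polynomial.X : Polynomial L) • c w' +
        (Polynomial.X : Polynomial L) ^ 2 • r := by
    have hQ : c (diagChain p y) = c (mainDiag y) *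
        Fin.partialProd (fun i => c (p i) * c (sideDiag y i)) (Fin.last n) := by
      simp only [diagChain, map_mul, map_partialProd]
    have hZQ : c e₀ + ∑ i, altProd (c (mainDiag y)) (fun i => c (sideDiag y i))
        (fun i => c (p i)) i * c (e i) * c (h' i) = c Z := by
      simp only [← map_altProd, ← hh, ← map_mul, ← map_sum, ← map_add, hZ]
    have hw : Z * diagChain p y = w' := by
      rw [mul_assoc, nonsing_inv_mul _ hchain, mul_one]
    rw [diagChain, hmain]
    simp only [hside]
    rw [hr, hsum, hZQ, ← hQ, add_mul, one_mul, smul_mul_assoc, ← map_mul, hw]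
  refine ⟨v, fun k => r k.1 k.2, fun k => ?_⟩
  have heval : (MvPolynomial.aeval z : _ →ₐ[L] _).toRingHom.mapMatrix
      (diagChain (fun i => MvPolynomial.C.mapMatrix (p i)) MvPolynomial.X) =
      diagChain (fun i => c (p i)) z := by
    rw [mapMatrix_diagChain]
    congr 1
    · ext i a b : 3
      simp [c, Polynomial.algebraMap_eq]
    · ext k : 1
      simp
  have hk := congrFun (congrFun (heval.trans hexp) k.1) k.2
  change MvPolynomial.aeval z _ = _ at hk
  change MvPolynomial.aeval z (chainPolynomial p (diagChain p y) k) = _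
  rw [chainPolynomial, map_sub, hk]
  simp [c, w', Polynomial.algebraMap_eq]
  ring

end Chain

section Fibers

open Matrix

variable {n : ℕ} {L : Type*} [Field L]

theorem card_le_of_diagChain_eq [Infinite L] {p : Fin n → Matrix (Fin n) (Fin n) L}
    (hp : ∀ i, IsUnit (p i)) (x : Matrix (Fin n) (Fin n) L) (P : Finset (Fin n × Fin n → L))
    (hP : ∀ y ∈ P, (∀ k, y k ≠ 0) ∧ diagChain p y = x ∧
      (sandwichMatrix (altProd (mainDiag y) (sideDiag y) p)).det ≠ 0) :
    P.card ≤ (n * n * (n + 1) + 1) ^ (n * n) := by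
  have := card_le_of_isNonsingularZero (totalDegree_chainPolynomial_le p x) (P := P) fun y hy => by
    obtain ⟨h0, rfl, hdet⟩ := hP y hy
    exact isNonsingularZero_chainPolynomial hp h0 hdet
  simpa using this

theorem partialProd_smul {A : Type*} [Ring A] [Algebra L A] (s : Fin n → L) (u : Fin n → A)
    (k : Fin (n + 1)) : Fin.partialProd (fun i => s i • u i) k =
      Fin.partialProd s k • Fin.partialProd u k := by
  induction k using Fin.induction with
  | zero => simp
  | succ k ih =>
    rw [Fin.partialProd_succ, Fin.partialProd_succ, Fin.partialProd_succ, ih, smul_mul_smul_comm]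

/-- The normalised coordinates of the diagonal matrices with entries `d.1` and `d.2 i`: the `i`-th
entry of `d.2 i` is moved to the front. -/
def normalizedCoord (d : (Fin n → L) × (Fin n → Fin n → L)) (k : Fin n × Fin n) : L :=
  if k.1 = k.2 then d.1 k.1 * ∏ i, d.2 i i else d.2 k.1 k.2 / d.2 k.1 k.1

section

variable {d : (Fin n → L) × (Fin n → Fin n → L)}

theorem normalizedCoord_ne_zero (h₁ : ∀ a, d.1 a ≠ 0) (h₂ : ∀ i a, d.2 i a ≠ 0)
    (k : Fin n × Fin n) : normalizedCoord d k ≠ 0 := by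
  rw [normalizedCoord]
  split_ifs
  · exact mul_ne_zero (h₁ _) (Finset.prod_ne_zero_iff.2 fun i _ => h₂ i i)
  · exact div_ne_zero (h₂ _ _) (h₂ _ _)

theorem mainDiag_normalizedCoord :
    mainDiag (normalizedCoord d) = (∏ i, d.2 i i) • diagonal d.1 := by
  ext a b
  simp only [mainDiag, normalizedCoord, Matrix.smul_apply, diagonal_apply, smul_eq_mul]
  split_ifs with h
  · exact mul_comm _ _
  · simp

theorem smul_sideDiag_normalizedCoord (h₂ : ∀ i a, d.2 i a ≠ 0) (i : Fin n) :
    d.2 i i • sideDiag (normalizedCoord d) i = diagonal (d.2 i) := by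
  ext a b
  simp only [sideDiag, normalizedCoord, Matrix.smul_apply, diagonal_apply, smul_eq_mul]
  split_ifs with h h'
  · rw [h', mul_one]
  · rw [mul_div_cancel₀ _ (h₂ i i)]
  · simp

theorem partialProd_diagonal (h₂ : ∀ i a, d.2 i a ≠ 0) (p : Fin n → Matrix (Fin n) (Fin n) L)
    (k : Fin (n + 1)) : Fin.partialProd (fun i => p i * diagonal (d.2 i)) k =
      Fin.partialProd (fun i => d.2 i i) k •
        Fin.partialProd (fun i => p i * sideDiag (normalizedCoord d) i) k := by
  rw [← partialProd_smul]
  congr 1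
  ext i : 1
  rw [← smul_sideDiag_normalizedCoord h₂, mul_smul_comm]

theorem diagChain_normalizedCoord (h₂ : ∀ i a, d.2 i a ≠ 0)
    (p : Fin n → Matrix (Fin n) (Fin n) L) :
    diagChain p (normalizedCoord d) =
      diagonal d.1 * Fin.partialProd (fun i => p i * diagonal (d.2 i)) (Fin.last n) := by
  have hs : Fin.partialProd (fun i => d.2 i i) (Fin.last n) = ∏ i, d.2 i i := by
    rw [Fin.partialProd, List.take_of_length_le (by simp), List.prod_ofFn]
  rw [partialProd_diagonal h₂, hs, diagChain, mainDiag_normalizedCoord, smul_mul_assoc,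
    mul_smul_comm]

theorem det_sandwichMatrix_normalizedCoord_ne_zero (h₂ : ∀ i a, d.2 i a ≠ 0)
    (p : Fin n → Matrix (Fin n) (Fin n) L)
    (h : (sandwichMatrix (altProd (diagonal d.1) (fun i => diagonal (d.2 i)) p)).det ≠ 0) :
    (sandwichMatrix (altProd (mainDiag (normalizedCoord d))
      (sideDiag (normalizedCoord d)) p)).det ≠ 0 := by
  have hs (i : Fin n) : Fin.partialProd (fun i => d.2 i i) i.castSucc ≠ 0 :=
    (isUnit_partialProd (fun i => (h₂ i i).isUnit) _).ne_zero
  have hP : ∏ i, d.2 i i ≠ 0 := Finset.prod_ne_zero_iff.2 fun i _ => h₂ i i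
  rw [← det_sandwichMatrix_smul_ne_zero_iff hs]
  rw [← det_sandwichMatrix_smul_ne_zero_iff fun _ => hP] at h
  convert h using 4 with i
  rw [altProd, altProd, partialProd_diagonal h₂, mainDiag_normalizedCoord]
  simp only [smul_mul_assoc, mul_smul_comm]
  rw [smul_comm]

end

theorem card_filter_normalizedCoord_eq_le (hn : 0 < n) [DecidableEq L]
    (F : Finset ((Fin n → L) × (Fin n → Fin n → L)))
    (hF : ∀ d ∈ F, ∏ a, d.1 a = 1 ∧ ∀ i, ∏ a, d.2 i a = 1) (y : Fin n × Fin n → L) :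
    (F.filter fun d => normalizedCoord d = y).card ≤ n ^ n := by
  let c (i : Fin n) : L := ∏ a, if i = a then 1 else y (i, a)
  have hd {d} (hd : d ∈ F.filter fun d => normalizedCoord d = y) (i a : Fin n) :
      d.2 i a = d.2 i i * if i = a then 1 else y (i, a) := by
    obtain ⟨hdF, rfl⟩ := Finset.mem_filter.1 hd
    have h0 : d.2 i i ≠ 0 := Finset.prod_ne_zero_iff.1
      (by rw [(hF d hdF).2 i]; exact one_ne_zero) i (Finset.mem_univ i)
    rw [normalizedCoord]
    split_ifs with h
    · rw [h, mul_one]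
    · exact (mul_div_cancel₀ _ h0).symm
  refine (Finset.card_le_card_of_injOn (t := Fintype.piFinset fun i =>
    (Polynomial.nthRoots n (c i)⁻¹).toFinset) (fun d i => d.2 i i) ?_ ?_).trans ?_
  · intro d hdF
    refine Fintype.mem_piFinset.2 fun i => ?_
    rw [Multiset.mem_toFinset, Polynomial.mem_nthRoots hn]
    refine eq_inv_of_mul_eq_one_left ?_
    rw [← (hF d (Finset.mem_filter.1 hdF).1).2 i, Finset.prod_congr rfl fun a _ => hd hdF i a,
      Finset.prod_mul_distrib]
    simp [c]
  · intro d hdF d' hdF' heq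
    have h₂ : d.2 = d'.2 := by
      ext i a
      rw [hd hdF, hd hdF', show d.2 i i = d'.2 i i from congrFun heq i]
    refine Prod.ext (funext fun a => ?_) h₂
    have := congrFun ((Finset.mem_filter.1 hdF).2.trans (Finset.mem_filter.1 hdF').2.symm) (a, a)
    simp only [normalizedCoord, if_true, h₂] at this
    refine mul_right_cancel₀ (Finset.prod_ne_zero_iff.2 fun i _ => ?_) this
    exact Finset.prod_ne_zero_iff.1 (by
      rw [(hF d' (Finset.mem_filter.1 hdF').1).2 i]; exact one_ne_zero) i (Finset.mem_univ i)
  · rw [Fintype.card_piFinset]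
    refine (Finset.prod_le_pow_card _ _ n fun i _ => ?_).trans_eq (by simp)
    exact (Multiset.toFinset_card_le _).trans (Polynomial.card_nthRoots n _)

theorem card_le_of_diagonal_product_eq (hn : 0 < n) [Infinite L]
    {p : Fin n → Matrix (Fin n) (Fin n) L} (hp : ∀ i, IsUnit (p i)) (x : Matrix (Fin n) (Fin n) L)
    (F : Finset ((Fin n → L) × (Fin n → Fin n → L)))
    (hF : ∀ d ∈ F, ∏ a, d.1 a = 1 ∧ ∀ i, ∏ a, d.2 i a = 1)
    (hx : ∀ d ∈ F, diagonal d.1 *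
      Fin.partialProd (fun i => p i * diagonal (d.2 i)) (Fin.last n) = x)
    (hdet : ∀ d ∈ F,
      (sandwichMatrix (altProd (diagonal d.1) (fun i => diagonal (d.2 i)) p)).det ≠ 0) :
    F.card ≤ n ^ n * (n * n * (n + 1) + 1) ^ (n * n) := by
  classical
  have hne {f : Fin n → L} (h : ∏ a, f a = 1) (a : Fin n) : f a ≠ 0 :=
    Finset.prod_ne_zero_iff.1 (by rw [h]; exact one_ne_zero) a (Finset.mem_univ a)
  refine (Finset.card_le_mul_card_image (f := normalizedCoord) F _ fun y _ =>
    card_filter_normalizedCoord_eq_le hn F hF y).trans (Nat.mul_le_mul_left _ ?_)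
  refine card_le_of_diagChain_eq hp x _ fun y hy => ?_
  obtain ⟨d, hd, rfl⟩ := Finset.mem_image.1 hy
  have h₁ := hne (hF d hd).1
  have h₂ := fun i => hne ((hF d hd).2 i)
  exact ⟨normalizedCoord_ne_zero h₁ h₂, (diagChain_normalizedCoord h₂ p).trans (hx d hd),
    det_sandwichMatrix_normalizedCoord_ne_zero h₂ p (hdet d hd)⟩

theorem card_filter_det_sandwichMatrix_ne_zero_le (hn : 0 < n) [Infinite L] {G : Type*} [Group G]
    [DecidableEq G] (ψ : G →* Matrix (Fin n) (Fin n) L) (hψ : Function.Injective ψ) (Λ : Finset G)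
    (δ : G → Fin n → L) (hδ : ∀ t ∈ Λ, ψ t = diagonal (δ t) ∧ ∏ a, δ t a = 1) (g : Fin n → G)
    (F : Finset (G × (Fin n → G))) (hF : ∀ τ ∈ F, τ.1 ∈ Λ ∧ ∀ i, τ.2 i ∈ Λ)
    (hdet : ∀ τ ∈ F, (sandwichMatrix fun i => ψ (altProd τ.1 τ.2 g i)).det ≠ 0) :
    F.card ≤ n ^ n * (n * n * (n + 1) + 1) ^ (n * n) *
      (F.image fun τ => τ.1 * Fin.partialProd (fun i => g i * τ.2 i) (Fin.last n)).card := by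
  classical
  refine Finset.card_le_mul_card_image F _ fun x _ => ?_
  set F' := F.filter fun τ => τ.1 * Fin.partialProd (fun i => g i * τ.2 i) (Fin.last n) = x
  have hF' {τ} (hτ : τ ∈ F') : τ ∈ F := (Finset.mem_filter.1 hτ).1
  let e (τ : G × (Fin n → G)) : (Fin n → L) × (Fin n → Fin n → L) := (δ τ.1, fun i => δ (τ.2 i))
  have hδ_inj {s t : G} (hs : s ∈ Λ) (ht : t ∈ Λ) (h : δ s = δ t) : s = t :=
    hψ (by rw [(hδ s hs).1, (hδ t ht).1, h])
  have he : Set.InjOn e F' := by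
    intro τ hτ τ' hτ' h
    obtain ⟨h₁, h₂⟩ := Prod.mk.inj h
    exact Prod.ext (hδ_inj (hF τ (hF' hτ)).1 (hF τ' (hF' hτ')).1 h₁) (funext fun i =>
      hδ_inj ((hF τ (hF' hτ)).2 i) ((hF τ' (hF' hτ')).2 i) (congrFun h₂ i))
  rw [← Finset.card_image_of_injOn he]
  refine card_le_of_diagonal_product_eq hn (p := fun i => ψ (g i))
    (fun i => (Group.isUnit (g i)).map ψ) (ψ x) _ ?_ ?_ ?_
  all_goals
    intro d hd
    obtain ⟨τ, hτ, rfl⟩ := Finset.mem_image.1 hd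
    obtain ⟨h₁, h₂⟩ := hF τ (hF' hτ)
  · exact ⟨(hδ _ h₁).2, fun i => (hδ _ (h₂ i)).2⟩
  · rw [← (Finset.mem_filter.1 hτ).2, map_mul, map_partialProd]
    simp only [e, ← (hδ _ h₁).1, fun i => (hδ _ (h₂ i)).1, map_mul]
  · have := hdet τ (hF' hτ)
    simp only [map_altProd] at this
    simpa only [e, ← (hδ _ h₁).1, ← fun i => (hδ _ (h₂ i)).1] using this

end Fibers


section Main

open Matrix

theorem partialProd_mem_pow {G : Type*} [Monoid G] {S : Set G} {n a : ℕ} {u : Fin n → G}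
    (hu : ∀ i, u i ∈ S ^ a) (k : Fin (n + 1)) : Fin.partialProd u k ∈ S ^ (k.val * a) := by
  induction k using Fin.induction with
  | zero => simp
  | succ k ih =>
    rw [Fin.partialProd_succ, Fin.val_succ, add_one_mul, pow_add]
    exact Set.mul_mem_mul ih (hu k)

theorem exists_mem_pow_of_closure_eq_top {G : Type*} [Group G] {A : Set G}
    (hA : Subgroup.closure A = ⊤) (g : G) : ∃ k, g ∈ (A ∪ A⁻¹ ∪ {1}) ^ k := by
  have hg : g ∈ Submonoid.closure (A ∪ A⁻¹) := by
    rw [← Subgroup.closure_toSubmonoid, hA]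
    trivial
  induction hg using Submonoid.closure_induction with
  | mem x hx => exact ⟨1, by rw [pow_one]; exact Or.inl hx⟩
  | one => exact ⟨0, by simp⟩
  | mul x y _ _ hx hy =>
    obtain ⟨k, hk⟩ := hx
    obtain ⟨l, hl⟩ := hy
    exact ⟨k + l, by rw [pow_add]; exact Set.mul_mem_mul hk hl⟩

theorem one_mem_prodSet {G : Type*} [Group G] (A : Set G) (k : ℕ) : 1 ∈ prodSet A k :=
  Set.one_mem_pow (Or.inr rfl)

variable {n : ℕ}

theorem card_specialLinearGroup_le (K : Type*) [Field K] [Fintype K] :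
    Nat.card (SpecialLinearGroup (Fin n) K) ≤ Fintype.card K ^ (n * n) := by
  classical
  refine (Nat.card_le_card_of_injective _ Subtype.val_injective).trans_eq ?_
  simp [Matrix, pow_mul]

/-- Conjugation by `γ⁻¹` as a representation of `SL_n(K)` over an extension `L` of `K`. -/
def conjHom {K L : Type*} [Field K] [Field L] [Algebra K L] (γ : (Matrix (Fin n) (Fin n) L)ˣ) :
    SpecialLinearGroup (Fin n) K →* Matrix (Fin n) (Fin n) L where
  toFun x := (γ⁻¹).1 * (algebraMap K L).mapMatrix x.1 * γ.1
  map_one' := by simp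
  map_mul' x y := by simp [mul_assoc]

section

variable {K L : Type*} [Field K] [Field L] [Algebra K L] (γ : (Matrix (Fin n) (Fin n) L)ˣ)

theorem conjHom_injective : Function.Injective (conjHom (K := K) γ) := by
  intro x y h
  have h' : (algebraMap K L).mapMatrix x.1 = (algebraMap K L).mapMatrix y.1 :=
    (Units.mul_right_inj γ⁻¹).1 ((Units.mul_left_inj γ).1 h)
  exact Subtype.ext (map_injective (algebraMap K L).injective h')

theorem det_conjHom (x : SpecialLinearGroup (Fin n) K) : (conjHom (L := L) γ x).det = 1 := by
  have hx : ((algebraMap K L).mapMatrix x.1).det = 1 := by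
    rw [← RingHom.map_det, show x.1.det = 1 from x.2, map_one]
  change ((γ⁻¹).1 * (algebraMap K L).mapMatrix x.1 * γ.1).det = 1
  rw [det_mul, det_mul, hx, mul_one, ← det_mul, Units.inv_mul, det_one]

end

theorem ncard_inter_torusPoints_pow_le_of_card_lt (hn : 0 < n) {K : Type*} [Field K] [Fintype K]
    (hK : n * n * ((n + 1) + n * (n + 1)) + n * n < Fintype.card K)
    {T : Set (SpecialLinearGroup (Fin n) (AlgebraicClosure K))}
    (hT : IsMaxTorus n (AlgebraicClosure K) T) {A : Set (SpecialLinearGroup (Fin n) K)}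
    (hA : Subgroup.closure A = ⊤) {m : ℕ} (hm : m = (n * n * n + 1) ^ (n * n * (n + n * n))) :
    (A ∩ torusPoints n K T).ncard ^ (n + 1) ≤
      m * (n ^ n * (n * n * (n + 1) + 1) ^ (n * n)) * (prodSet A (1 + n * (m + 1))).ncard := by
  classical
  obtain ⟨γ, rfl⟩ := hT
  set T := {x : SpecialLinearGroup (Fin n) (AlgebraicClosure K) | ∃ d, IsDiag d ∧
    x.1 = γ.1 * d * (γ⁻¹).1}
  let S : Set (SpecialLinearGroup (Fin n) K) := A ∪ A⁻¹ ∪ {1}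
  have h1 : 1 ∈ S := Or.inr rfl
  obtain ⟨E, hE, hES, hgood⟩ := exists_finset_det_sandwichMatrix_altProd_ne_zero
    (L := AlgebraicClosure K) hn hK γ h1 (exists_mem_pow_of_closure_eq_top hA) hm
  let ψ := conjHom (K := K) γ
  let Λ : Finset (SpecialLinearGroup (Fin n) K) := (A ∩ torusPoints n K T).toFinset
  have hΛA {t} (ht : t ∈ Λ) : t ∈ S ^ 1 := by
    rw [pow_one]
    exact Or.inl (Or.inl (Set.mem_toFinset.1 ht).1)
  have hΛ (t) (ht : t ∈ Λ) : ψ t = diagonal (ψ t).diag ∧ ∏ a, (ψ t).diag a = 1 := by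
    obtain ⟨d, hd, h⟩ := (Set.mem_toFinset.1 ht).2
    have hψ : ψ t = d := by
      have h' : (algebraMap K (AlgebraicClosure K)).mapMatrix t.1 = γ.1 * d * (γ⁻¹).1 := h
      change (γ⁻¹).1 * (algebraMap K (AlgebraicClosure K)).mapMatrix t.1 * γ.1 = d
      rw [h']
      simp [mul_assoc]
    have hdiag : ψ t = diagonal (ψ t).diag := by rw [hψ, hd.diagonal_diag]
    refine ⟨hdiag, ?_⟩
    rw [← det_diagonal, ← hdiag, det_conjHom]
  let F (g : Fin n → SpecialLinearGroup (Fin n) K) :=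
    (Λ ×ˢ Fintype.piFinset fun _ : Fin n => Λ).filter fun τ =>
      (sandwichMatrix fun i => ψ (altProd τ.1 τ.2 g i)).det ≠ 0
  have hcard : (A ∩ torusPoints n K T).ncard ^ (n + 1) =
      (Λ ×ˢ Fintype.piFinset fun _ : Fin n => Λ).card := by
    rw [Finset.card_product, Fintype.card_piFinset_const, ← pow_succ', Set.ncard_eq_toFinset_card']
  have hcover : (Λ ×ˢ Fintype.piFinset fun _ : Fin n => Λ) ⊆ E.biUnion F := by
    intro τ hτ
    obtain ⟨g, hg, hdet⟩ := hgood τ.1 τ.2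
    exact Finset.mem_biUnion.2 ⟨g, hg, Finset.mem_filter.2 ⟨hτ, hdet⟩⟩
  have hF (g) (hg : g ∈ E) : (F g).card ≤ n ^ n * (n * n * (n + 1) + 1) ^ (n * n) *
      (prodSet A (1 + n * (m + 1))).ncard := by
    have hmem (τ) (hτ : τ ∈ F g) : τ.1 ∈ Λ ∧ ∀ i, τ.2 i ∈ Λ := by
      have := Finset.mem_product.1 (Finset.mem_filter.1 hτ).1
      exact ⟨this.1, Fintype.mem_piFinset.1 this.2⟩
    refine (card_filter_det_sandwichMatrix_ne_zero_le hn ψ (conjHom_injective γ) Λ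
      (fun t => (ψ t).diag) hΛ g (F g) hmem fun τ hτ => (Finset.mem_filter.1 hτ).2).trans
      (Nat.mul_le_mul_left _ ?_)
    rw [← Set.ncard_coe_finset]
    refine Set.ncard_le_ncard ?_ (Set.toFinite _)
    intro x hx
    obtain ⟨τ, hτ, rfl⟩ := Finset.mem_image.1 hx
    obtain ⟨ht₀, ht⟩ := hmem τ hτ
    rw [prodSet, pow_add]
    refine Set.mul_mem_mul (hΛA ht₀) (partialProd_mem_pow (fun i => ?_) (Fin.last n))
    rw [pow_add]
    exact Set.mul_mem_mul (hES g hg i) (hΛA (ht i))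
  calc (A ∩ torusPoints n K T).ncard ^ (n + 1) ≤ (E.biUnion F).card :=
        hcard.trans_le (Finset.card_le_card hcover)
    _ ≤ E.card * _ := Finset.card_biUnion_le_card_mul _ _ _ hF
    _ ≤ m * _ := Nat.mul_le_mul_right _ hE
    _ = _ := (mul_assoc _ _ _).symm

theorem exists_ncard_inter_torusPoints_pow_le (hn : 0 < n) :
    ∃ N k : ℕ, 0 < N ∧ 0 < k ∧ ∀ (K : Type) [Field K] [Fintype K],
      ∀ T : Set (SpecialLinearGroup (Fin n) (AlgebraicClosure K)),
        IsMaxTorus n (AlgebraicClosure K) T → ∀ A : Set (SpecialLinearGroup (Fin n) K),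
          Subgroup.closure A = ⊤ →
            (A ∩ torusPoints n K T).ncard ^ (n + 1) ≤ N * (prodSet A k).ncard := by
  let q := n * n * ((n + 1) + n * (n + 1)) + n * n
  let m := (n * n * n + 1) ^ (n * n * (n + n * n))
  let N₁ := m * (n ^ n * (n * n * (n + 1) + 1) ^ (n * n))
  let N₂ := (q ^ (n * n)) ^ (n + 1)
  refine ⟨N₁ + N₂, 1 + n * (m + 1), by positivity, by positivity, fun K _ _ T hT A hA => ?_⟩
  rcases lt_or_ge q (Fintype.card K) with hK | hK
  · exact (ncard_inter_torusPoints_pow_le_of_card_lt hn hK hT hA rfl).trans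
      (Nat.mul_le_mul_right _ (Nat.le_add_right _ _))
  · have hΛ : (A ∩ torusPoints n K T).ncard ≤ q ^ (n * n) :=
      (Set.ncard_le_card _).trans
        ((card_specialLinearGroup_le K).trans (Nat.pow_le_pow_left hK _))
    have hpos : 0 < (prodSet A (1 + n * (m + 1))).ncard :=
      (Set.ncard_pos (Set.toFinite _)).2 ⟨1, one_mem_prodSet A _⟩
    calc (A ∩ torusPoints n K T).ncard ^ (n + 1) ≤ N₂ := Nat.pow_le_pow_left hΛ _
      _ ≤ N₁ + N₂ := Nat.le_add_left _ _
      _ ≤ _ := Nat.le_mul_of_pos_right _ hpos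

end Main

/-- For `n ≥ 2` there are `C > 0` and `k ≥ 1` such that for every finite field `K` of
characteristic `≠ 2`, every maximal torus `T` of `SL_n` over `K̄`, and every generating
set `A` of `SL_n(K)`, one has `|A ∩ T(K)| ≤ C·|A_k|^(1/(n+1))`. -/
theorem statement_2 (n : ℕ) (hn : 2 ≤ n) :
    ∃ (C : ℝ) (k : ℕ), 0 < C ∧ 0 < k ∧
      ∀ (K : Type) [Field K] [Fintype K], ringChar K ≠ 2 →
        ∀ T : Set (Matrix.SpecialLinearGroup (Fin n) (AlgebraicClosure K)),
          IsMaxTorus n (AlgebraicClosure K) T →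
          ∀ A : Set (Matrix.SpecialLinearGroup (Fin n) K),
            Subgroup.closure A = ⊤ →
            ((A ∩ torusPoints n K T).ncard : ℝ) ≤
              C * ((prodSet A k).ncard : ℝ) ^ ((1 : ℝ) / (n + 1)) := by
  obtain ⟨N, k, hN, hk, h⟩ := exists_ncard_inter_torusPoints_pow_le (n := n) (by omega)
  refine ⟨(N : ℝ) ^ ((1 : ℝ) / (n + 1)), k, by positivity, hk, fun K _ _ _ T hT A hA => ?_⟩
  have hle : ((A ∩ torusPoints n K T).ncard : ℝ) ^ (n + 1) ≤ N * (prodSet A k).ncard := by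
    exact_mod_cast h K T hT A hA
  rw [← Real.mul_rpow (by positivity) (by positivity)]
  have hpow := Real.pow_rpow_inv_natCast
    (Nat.cast_nonneg (A ∩ torusPoints n K T).ncard : (0 : ℝ) ≤ _) (Nat.succ_ne_zero n)
  rw [← hpow, Nat.cast_succ, ← one_div]
  exact Real.rpow_le_rpow (by positivity) hle (by positivity)
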